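/- arXiv:2510.11441 — 2 statements merged into one kernel-verified Lean document; each statement's English description precedes it below -/
import Mathlib

section
/- For all parameters a ∈ ℝ/ℤ, b ∈ [0,1] and all x ∈ ℝ/ℤ, the piecewise linear perturbation of the doubling map satisfies the symmetry f_{1/2−a,b}(1/2−x) = 1/2 − f_{a,b}(x). -/
open Set Filter Topology

noncomputable section

/-- Representative of a point of the circle in `[0,1)`. -/
noncomputable def rep (z : UnitAddCircle) : ℝ := (AddCircle.equivIco 1 0 z).val

/-- The straight sine map on `[0,1)`. -/
noncomputable def Sfun (t : ℝ) : ℝ := if t ≤ 1/2 then 4*t - 1 else -4*t + 3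

/-- The piecewise linear perturbation of the doubling map. -/
noncomputable def plpdm (a : UnitAddCircle) (b : ℝ) (z : UnitAddCircle) : UnitAddCircle :=
  ((2 * rep z + (b/2) * Sfun (rep z) : ℝ) : UnitAddCircle) + a

/-- The doubling map. -/
def Dbl (z : UnitAddCircle) : UnitAddCircle := z + z

/-- `x` is an attracting periodic point of `f` of exact period `n`. -/
def IsAttractingPeriodicPt (f : UnitAddCircle → UnitAddCircle) (n : ℕ)
    (x : UnitAddCircle) : Prop :=
  0 < n ∧ f^[n] x = x ∧ (∀ m, 0 < m → m < n → f^[m] x ≠ x) ∧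
  ∃ U : Set UnitAddCircle, IsOpen U ∧ IsConnected U ∧ x ∈ U ∧ f^[n] '' U ⊆ U ∧
    ∀ y ∈ U, Tendsto (fun k => f^[n*k] y) atTop (nhds x)

/-- Forward orbit of `x` under `f`. -/
def orbitSet (f : UnitAddCircle → UnitAddCircle) (x : UnitAddCircle) : Set UnitAddCircle :=
  {y | ∃ i, f^[i] x = y}

/-- Basin of attraction of the set `O`. -/
def basin (f : UnitAddCircle → UnitAddCircle) (O : Set UnitAddCircle) : Set UnitAddCircle :=
  {y | Tendsto (fun k => Metric.infDist (f^[k] y) O) atTop (nhds 0)}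

/-- Immediate basin of attraction of the orbit `O`. -/
def immBasin (f : UnitAddCircle → UnitAddCircle) (O : Set UnitAddCircle) :
    Set UnitAddCircle :=
  ⋃ z ∈ O, connectedComponentIn (basin f O) z

/-- The hyperbolic set `H`. -/
def hypSet : Set (UnitAddCircle × ℝ) :=
  {q | q.2 ∈ Set.Ico (0:ℝ) 1 ∧ ∃ n x, IsAttractingPeriodicPt (plpdm q.1 q.2) n x}

/-- The lift `F_{a,b}` of `f_{a,b}`, normalized so that `F_{a,b}(0) ∈ [0,1)`. -/
noncomputable def liftF (a : UnitAddCircle) (b : ℝ) (x : ℝ) : ℝ :=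
  (2 * Int.fract x + rep a + (b/2) * Sfun (Int.fract x)
    + (if rep a - b/2 < 0 then 1 else 0)) + 2 * (⌊x⌋ : ℝ)

/-- `Φ_{a,b}`, the limit of `F_{a,b}^n(x)/2^n`. -/
noncomputable def Phi (a : UnitAddCircle) (b : ℝ) (x : ℝ) : ℝ :=
  limUnder atTop (fun n : ℕ => (liftF a b)^[n] x / 2 ^ n)

/-- The semiconjugacy `φ_{a,b}` induced by `Φ_{a,b}`. -/
noncomputable def phiMap (a : UnitAddCircle) (b : ℝ) (z : UnitAddCircle) : UnitAddCircle :=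
  ((Phi a b (rep z) : ℝ) : UnitAddCircle)

/-- The arc `I₊ = [0,1/2]` of the circle. -/
def Iplus : Set UnitAddCircle := (fun t : ℝ => (t : UnitAddCircle)) '' Set.Icc 0 (1/2)

/-- The arc `I₋ = [1/2,1]` of the circle. -/
def Iminus : Set UnitAddCircle := (fun t : ℝ => (t : UnitAddCircle)) '' Set.Icc (1/2) 1

/-- The orbit of `x` (of period `p`) avoids `0`, `1/2` and has slope itinerary `σ`,
where `σ j = true` encodes the symbol `−` and `σ j = false` encodes `+`. -/
def HasItinerary (f : UnitAddCircle → UnitAddCircle) (p : ℕ) (x : UnitAddCircle)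
    (σ : Fin p → Bool) : Prop :=
  (∀ j : Fin p, f^[(j : ℕ)] x ≠ (0 : UnitAddCircle) ∧
      f^[(j : ℕ)] x ≠ (((1:ℝ)/2 : ℝ) : UnitAddCircle)) ∧
  ∀ j : Fin p, (σ j = true → f^[(j : ℕ)] x ∈ Iminus) ∧ (σ j = false → f^[(j : ℕ)] x ∈ Iplus)

/-- The set `P_σ` of parameters whose attracting orbit has slope itinerary `σ`. -/
def paramSet (p : ℕ) (σ : Fin p → Bool) : Set (UnitAddCircle × ℝ) :=
  {q | q.2 ∈ Set.Ico (0:ℝ) 1 ∧ ∃ x, IsAttractingPeriodicPt (plpdm q.1 q.2) p x ∧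
       HasItinerary (plpdm q.1 q.2) p x σ}

/-- `S` is a tongue: its closure meets `ℝ/ℤ × {1}` in a nondegenerate interval. -/
def IsTongue (S : Set (UnitAddCircle × ℝ)) : Prop :=
  ∃ u v : ℝ, u < v ∧ ∀ t ∈ Set.Icc u v, (((t : ℝ) : UnitAddCircle), (1:ℝ)) ∈ closure S

end


theorem rep_mem_Ico (z : UnitAddCircle) : rep z ∈ Set.Ico (0 : ℝ) 1 := by
  simpa [rep] using (AddCircle.equivIco 1 0 z).2

theorem coe_rep (z : UnitAddCircle) : ((rep z : ℝ) : UnitAddCircle) = z :=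
  (AddCircle.equivIco 1 0).symm_apply_apply z

theorem rep_coe_of_mem_Ico {t : ℝ} (ht : t ∈ Set.Ico (0 : ℝ) 1) :
    rep (t : UnitAddCircle) = t := by
  have h := AddCircle.coe_equivIco_mk_apply (1 : ℝ) t
  rw [div_one, mul_one, Int.fract_eq_self.2 ht] at h
  exact h

theorem rep_half_sub (z : UnitAddCircle) :
    rep ((((1:ℝ)/2 : ℝ) : UnitAddCircle) - z)
      = if rep z ≤ 1/2 then 1/2 - rep z else 3/2 - rep z := by
  obtain ⟨h0, h1⟩ := rep_mem_Ico z
  split_ifs with h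
  · rw [← rep_coe_of_mem_Ico (t := 1/2 - rep z) ⟨by linarith, by linarith⟩,
      AddCircle.coe_sub, coe_rep]
  · rw [← rep_coe_of_mem_Ico (t := 3/2 - rep z) ⟨by linarith, by linarith⟩,
      show (3/2 : ℝ) - rep z = 1/2 - rep z + 1 by ring, AddCircle.coe_add_period,
      AddCircle.coe_sub, coe_rep]

theorem Sfun_rep_half_sub (z : UnitAddCircle) :
    Sfun (rep ((((1:ℝ)/2 : ℝ) : UnitAddCircle) - z)) = -Sfun (rep z) := by
  obtain ⟨h0, h1⟩ := rep_mem_Ico z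
  rw [rep_half_sub]
  unfold Sfun
  split_ifs <;> linarith

theorem coe_two_mul_rep (z : UnitAddCircle) : ((2 * rep z : ℝ) : UnitAddCircle) = z + z := by
  rw [two_mul, AddCircle.coe_add, coe_rep]

theorem stmt0 (a x : UnitAddCircle) (b : ℝ) (hb : b ∈ Set.Icc (0:ℝ) 1) :
    plpdm ((((1:ℝ)/2 : ℝ) : UnitAddCircle) - a) b ((((1:ℝ)/2 : ℝ) : UnitAddCircle) - x)
      = (((1:ℝ)/2 : ℝ) : UnitAddCircle) - plpdm a b x := by
  have h : (((1:ℝ)/2 : ℝ) : UnitAddCircle) + (((1:ℝ)/2 : ℝ) : UnitAddCircle) = 0 := by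
    rw [← AddCircle.coe_add, add_halves, AddCircle.coe_period]
  unfold plpdm
  rw [Sfun_rep_half_sub, AddCircle.coe_add, AddCircle.coe_add, coe_two_mul_rep, coe_two_mul_rep,
    mul_neg, AddCircle.coe_neg, sub_add_sub_comm, h]
  abel
end

section
/- Let (a,b) ∈ ℝ/ℤ × [0,1] and suppose f_{a,b} has an attracting periodic orbit. If x is the point of this orbit lying in I_− that is closest to 1/2 within I_− (i.e. with smallest representative in [1/2,1] among the orbit points in I_−), then 1/2 belongs to the closure of the connected component of the basin of attraction that contains x. -/
open Set Filter Topology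

lemma rep_coe (t : ℝ) : rep (t : UnitAddCircle) = Int.fract t := by
  simp [rep, AddCircle.coe_equivIco_mk_apply]

lemma Sfun_fract (t : ℝ) : Sfun (Int.fract t) = 4 * ‖(t : UnitAddCircle)‖ - 1 := by
  rw [UnitAddCircle.norm_eq, abs_sub_round_eq_min, Sfun]
  split_ifs with h
  · rw [min_eq_left (by linarith)]
  · rw [min_eq_right (by linarith)]; ring

/-- A lift of `plpdm α b` to the real line. -/
noncomputable def realLift (α b t : ℝ) : ℝ :=
  2 * t + α + (b / 2) * (4 * ‖(t : UnitAddCircle)‖ - 1)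

lemma coe_intCast (m : ℤ) : ((m : ℝ) : UnitAddCircle) = 0 :=
  (AddCircle.coe_eq_zero_iff 1).2 ⟨m, by simp⟩

lemma coe_sub_intCast (t : ℝ) (m : ℤ) : ((t - m : ℝ) : UnitAddCircle) = t := by
  rw [AddCircle.coe_sub, coe_intCast, sub_zero]

lemma coe_realLift (α b t : ℝ) :
    (realLift α b t : UnitAddCircle) = plpdm (α : UnitAddCircle) b (t : UnitAddCircle) := by
  rw [plpdm, rep_coe, Sfun_fract, ← AddCircle.coe_add, ← coe_sub_intCast _ (2 * ⌊t⌋)]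
  congr 1
  rw [realLift, Int.fract]
  push_cast
  ring

lemma norm_coe_le_abs (t : ℝ) : ‖(t : UnitAddCircle)‖ ≤ |t| := by
  rw [UnitAddCircle.norm_eq]
  simpa using round_le t 0

lemma continuous_realLift (α b : ℝ) : Continuous (realLift α b) := by
  have : Continuous fun t : ℝ => ‖(t : UnitAddCircle)‖ :=
    continuous_norm.comp (AddCircle.continuous_mk' 1)
  unfold realLift
  fun_prop

lemma monotone_realLift (α : ℝ) {b : ℝ} (hb : b ∈ Icc (0 : ℝ) 1) :
    Monotone (realLift α b) := by
  intro s t hst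
  have h : ‖(s : UnitAddCircle)‖ - ‖(t : UnitAddCircle)‖ ≤ t - s := by
    refine (norm_sub_norm_le _ _).trans ?_
    rw [norm_sub_rev, ← AddCircle.coe_sub]
    exact (norm_coe_le_abs _).trans_eq (abs_of_nonneg (sub_nonneg.2 hst))
  unfold realLift
  linarith [mul_le_mul_of_nonneg_left h hb.1,
    mul_nonneg (sub_nonneg.2 hb.2) (sub_nonneg.2 hst)]

lemma norm_coe_eq_abs_sub {m : ℤ} {t : ℝ} (ht : t ∈ Icc (1 / 2 + m : ℝ) (1 / 2 + m + 1)) :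
    ‖(t : UnitAddCircle)‖ = |t - (m + 1 : ℤ)| := by
  rw [← coe_sub_intCast t (m + 1), AddCircle.norm_coe_eq_abs_iff 1 one_ne_zero, abs_le]
  push_cast
  rw [abs_one]
  constructor <;> linarith [ht.1, ht.2]

/-- The lift is convex between two consecutive lifts of `1/2`. -/
lemma realLift_convex_le (α : ℝ) {b : ℝ} (hb : 0 ≤ b) {m : ℤ} {s t μ ν : ℝ}
    (hs : s ∈ Icc (1 / 2 + m : ℝ) (1 / 2 + m + 1))
    (ht : t ∈ Icc (1 / 2 + m : ℝ) (1 / 2 + m + 1))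
    (hμ : 0 ≤ μ) (hν : 0 ≤ ν) (h : μ + ν = 1) :
    realLift α b (μ * s + ν * t) ≤ μ * realLift α b s + ν * realLift α b t := by
  have hst := (convex_Icc (1 / 2 + m : ℝ) (1 / 2 + m + 1)) hs ht hμ hν h
  simp only [smul_eq_mul] at hst
  unfold realLift
  rw [norm_coe_eq_abs_sub hs, norm_coe_eq_abs_sub ht, norm_coe_eq_abs_sub hst]
  have key : |μ * s + ν * t - (m + 1 : ℤ)| ≤ μ * |s - (m + 1 : ℤ)| + ν * |t - (m + 1 : ℤ)| := by
    rw [← abs_of_nonneg hμ, ← abs_of_nonneg hν, ← abs_mul, ← abs_mul,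
      abs_of_nonneg hμ, abs_of_nonneg hν]
    refine le_trans (le_of_eq ?_) (abs_add_le _ _)
    congr 1
    linear_combination (-(m + 1 : ℤ) : ℝ) * (-h)
  have := mul_le_mul_of_nonneg_left key hb
  obtain rfl : ν = 1 - μ := by linarith
  linarith

lemma continuous_plpdm (a : UnitAddCircle) (b : ℝ) : Continuous (plpdm a b) := by
  obtain ⟨α, rfl⟩ := QuotientAddGroup.mk_surjective a
  refine (QuotientAddGroup.isQuotientMap_mk _).continuous_iff.2 ?_
  exact ((AddCircle.continuous_mk' 1).comp (continuous_realLift α b)).congr (coe_realLift α b)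

/-- If the first `n` images of an interval contain no lift of `1/2` in their interiors, then the
`n`-th iterate of the lift lies below its chord on that interval. -/
lemma iterate_realLift_convex_le (α : ℝ) {b : ℝ} (hb : b ∈ Icc (0 : ℝ) 1) {l r : ℝ} {n : ℕ}
    (hlr : l ≤ r)
    (h : ∀ i < n, ∀ m : ℤ, (1 / 2 + m : ℝ) ∉ Ioo ((realLift α b)^[i] l) ((realLift α b)^[i] r))
    {μ ν : ℝ} (hμ : 0 ≤ μ) (hν : 0 ≤ ν) (hμν : μ + ν = 1) :
    (realLift α b)^[n] (μ * l + ν * r) ≤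
      μ * (realLift α b)^[n] l + ν * (realLift α b)^[n] r := by
  induction n with
  | zero => simp
  | succ n ih =>
    have hmono := monotone_realLift α hb
    have hle := hmono.iterate n hlr
    specialize ih fun i hi => h i (by omega)
    simp only [Function.iterate_succ_apply']
    refine (hmono ih).trans ?_
    set u := (realLift α b)^[n] l
    set v := (realLift α b)^[n] r
    have h1 := Int.floor_le (u - 1 / 2)
    have h2 := Int.lt_floor_add_one (u - 1 / 2)
    have h3 : v ≤ 1 / 2 + ⌊u - 1 / 2⌋ + 1 := by
      by_contra! hv
      refine h n (by omega) (⌊u - 1 / 2⌋ + 1) ⟨?_, ?_⟩ <;> push_cast <;> linarith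
    refine realLift_convex_le α hb.1 (m := ⌊u - 1 / 2⌋) ⟨?_, ?_⟩ ⟨?_, ?_⟩ hμ hν hμν <;> linarith

section Basin

variable {f : UnitAddCircle → UnitAddCircle} {n : ℕ} {x : UnitAddCircle}

lemma tendsto_iterate_mul_add (hf : Continuous f) (i : ℕ) {y : UnitAddCircle}
    (hy : Tendsto (fun k => f^[n * k] y) atTop (𝓝 x)) :
    Tendsto (fun k => f^[i] (f^[n * k] y)) atTop (𝓝 (f^[i] x)) :=
  ((hf.iterate i).tendsto x).comp hy

lemma mem_basin_of_tendsto (hf : Continuous f) (hn : 0 < n) {y : UnitAddCircle}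
    (hy : Tendsto (fun k => f^[n * k] y) atTop (𝓝 x)) : y ∈ basin f (orbitSet f x) := by
  have hsum : Tendsto (fun k => ∑ i ∈ Finset.range n, dist (f^[i] (f^[n * k] y)) (f^[i] x))
      atTop (𝓝 0) := by
    simpa using tendsto_finsetSum (Finset.range n) fun i _ =>
      tendsto_iff_dist_tendsto_zero.1 (tendsto_iterate_mul_add hf i hy)
  refine squeeze_zero (fun _ => Metric.infDist_nonneg) (fun j => ?_)
    (hsum.comp (Nat.tendsto_div_const_atTop hn.ne'))
  have hj : f^[j] y = f^[j % n] (f^[n * (j / n)] y) := by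
    rw [← Function.iterate_add_apply, Nat.mod_add_div]
  rw [hj]
  have hmem : f^[j % n] x ∈ orbitSet f x := ⟨j % n, rfl⟩
  refine (Metric.infDist_le_dist_of_mem hmem).trans ?_
  exact Finset.single_le_sum (f := fun i => dist (f^[i] (f^[n * (j / n)] y)) (f^[i] x))
    (fun _ _ => dist_nonneg) (Finset.mem_range.2 (Nat.mod_lt _ hn))

lemma iterate_mem_basin_iff {O : Set UnitAddCircle} {y : UnitAddCircle} (i : ℕ) :
    f^[i] y ∈ basin f O ↔ y ∈ basin f O := by
  simp only [basin, mem_ofPred_eq, ← Function.iterate_add_apply]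
  exact tendsto_add_atTop_iff_nat (f := fun k => Metric.infDist (f^[k] y) O) i

lemma orbitSet_subset_basin : orbitSet f x ⊆ basin f (orbitSet f x) := by
  rintro _ ⟨i, rfl⟩
  refine tendsto_const_nhds.congr fun k => (Metric.infDist_zero_of_mem ?_).symm
  exact ⟨k + i, Function.iterate_add_apply f k i x⟩

lemma finite_orbitSet (hn : 0 < n) (hx : f^[n] x = x) : (orbitSet f x).Finite := by
  refine ((Finset.range n).finite_toSet.image fun i => f^[i] x).subset ?_
  rintro _ ⟨i, rfl⟩
  exact ⟨i % n, by simpa using Nat.mod_lt i hn, Function.IsPeriodicPt.iterate_mod_apply hx i⟩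

lemma iterate_sub_orbit (hn : 0 < n) (hx : f^[n] x = x) (i : ℕ) :
    f^[n * i - i] (f^[i] x) = x := by
  rw [← Function.iterate_add_apply, Nat.sub_add_cancel (Nat.le_mul_of_pos_left i hn)]
  exact Function.IsPeriodicPt.mul_const (f := f) (m := n) hx i

lemma isOpen_basin (hf : Continuous f) (hx : IsAttractingPeriodicPt f n x) :
    IsOpen (basin f (orbitSet f x)) := by
  obtain ⟨hn, hper, -, U, hUo, -, hxU, -, hU⟩ := hx
  have hVo : IsOpen (⋃ k, f^[k] ⁻¹' U) := isOpen_iUnion fun k => hUo.preimage (hf.iterate k)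
  suffices basin f (orbitSet f x) = ⋃ k, f^[k] ⁻¹' U from this ▸ hVo
  refine Subset.antisymm (fun y hy => ?_) (iUnion_subset fun k y hy =>
    (iterate_mem_basin_iff k).1 (mem_basin_of_tendsto hf hn (hU _ hy)))
  have hOV : orbitSet f x ⊆ ⋃ k, f^[k] ⁻¹' U := by
    rintro _ ⟨i, rfl⟩
    refine mem_iUnion.2 ⟨n * i - i, ?_⟩
    rwa [mem_preimage, iterate_sub_orbit hn hper]
  obtain ⟨δ, hδ, hsub⟩ :=
    (finite_orbitSet hn hper).isCompact.exists_thickening_subset_open hVo hOV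
  obtain ⟨j, hj⟩ := (hy.eventually_lt_const hδ).exists
  have hne : (orbitSet f x).Nonempty := ⟨x, 0, rfl⟩
  obtain ⟨k, hk⟩ := mem_iUnion.1 (hsub ((Metric.mem_thickening_iff_infDist_lt hne).2 hj))
  refine mem_iUnion.2 ⟨k + j, ?_⟩
  rwa [mem_preimage, Function.iterate_add_apply]

/-- Every point of an attracting orbit attracts its neighbours. -/
lemma eventually_tendsto_of_mem_orbitSet (hf : Continuous f) (hx : IsAttractingPeriodicPt f n x)
    {z : UnitAddCircle} (hz : z ∈ orbitSet f x) :
    ∀ᶠ y in 𝓝 z, Tendsto (fun k => f^[n * k] y) atTop (𝓝 z) := by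
  obtain ⟨hn, hper, -, U, hUo, -, hxU, -, hU⟩ := hx
  obtain ⟨i, rfl⟩ := hz
  have hnhds : f^[n * i - i] ⁻¹' U ∈ 𝓝 (f^[i] x) := by
    refine (hUo.preimage (hf.iterate _)).mem_nhds ?_
    rwa [mem_preimage, iterate_sub_orbit hn hper]
  filter_upwards [hnhds] with y hy
  refine (tendsto_add_atTop_iff_nat i).1
    ((tendsto_iterate_mul_add hf i (hU _ hy)).congr fun k => ?_)
  rw [← Function.iterate_add_apply, ← Function.iterate_add_apply]
  congr 1
  have := Nat.le_mul_of_pos_left i hn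
  rw [mul_add]
  omega

end Basin

theorem stmt1 (a : UnitAddCircle) (b : ℝ) (hb : b ∈ Set.Icc (0:ℝ) 1)
    (n : ℕ) (x₀ : UnitAddCircle)
    (hx₀ : IsAttractingPeriodicPt (plpdm a b) n x₀)
    (x : UnitAddCircle) (hx : x ∈ orbitSet (plpdm a b) x₀)
    (ξ : ℝ) (hξ : ξ ∈ Set.Icc (1/2 : ℝ) 1) (hxξ : x = ((ξ : ℝ) : UnitAddCircle))
    (hmin : ∀ y ∈ orbitSet (plpdm a b) x₀, ∀ η ∈ Set.Icc (1/2 : ℝ) 1,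
      y = ((η : ℝ) : UnitAddCircle) → ξ ≤ η) :
    (((1:ℝ)/2 : ℝ) : UnitAddCircle) ∈
      closure (connectedComponentIn (basin (plpdm a b) (orbitSet (plpdm a b) x₀)) x) := by
  obtain ⟨α, rfl⟩ := QuotientAddGroup.mk_surjective a
  have hf := continuous_plpdm (α : UnitAddCircle) b
  have hF := continuous_realLift α b
  have hmono := monotone_realLift α hb
  have hopen := isOpen_basin hf hx₀
  have hattr := eventually_tendsto_of_mem_orbitSet hf hx₀ hx
  have hper : (plpdm α b)^[n] x = x := by
    obtain ⟨i, rfl⟩ := hx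
    exact Function.IsPeriodicPt.apply_iterate hx₀.2.1 i
  have hxB := orbitSet_subset_basin hx
  have hxO : ∀ i, (plpdm α b)^[i] x ∈ orbitSet (plpdm α b) x₀ := by
    obtain ⟨j, rfl⟩ := hx
    exact fun i => ⟨i + j, Function.iterate_add_apply _ i j x₀⟩
  have hsemi : ∀ (i : ℕ) (t : ℝ),
      ((realLift α b)^[i] t : UnitAddCircle) = (plpdm α b)^[i] (t : UnitAddCircle) :=
    fun i => Function.Semiconj.iterate_right (f := fun t : ℝ => (t : UnitAddCircle))
      (coe_realLift α b) i
  have hcoe : Continuous fun t : ℝ => (t : UnitAddCircle) := AddCircle.continuous_mk' 1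
  change _ ∈ closure (connectedComponentIn (basin (plpdm α b) (orbitSet (plpdm α b) x₀)) x)
  set B := basin (plpdm α b) (orbitSet (plpdm α b) x₀)
  subst hxξ
  suffices hB : ∀ y ∈ Icc (1 / 2) ξ, (y : UnitAddCircle) ∈ B by
    refine subset_closure (IsPreconnected.subset_connectedComponentIn
      (isPreconnected_Icc.image _ hcoe.continuousOn) ⟨ξ, ⟨hξ.1, le_rfl⟩, rfl⟩ ?_
      ⟨1 / 2, ⟨le_rfl, hξ.1⟩, rfl⟩)
    rintro _ ⟨y, hy, rfl⟩
    exact hB y hy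
  by_contra! hB
  obtain ⟨l, ⟨hl, hlB⟩, hmax⟩ := (isCompact_Icc.inter_right
    (hopen.isClosed_compl.preimage hcoe)).exists_isGreatest hB
  have hgt : ∀ y, l < y → y ≤ ξ → (y : UnitAddCircle) ∈ B := fun y hly hy => by
    by_contra hyB
    exact hly.not_ge (hmax ⟨⟨hl.1.trans hly.le, hy⟩, hyB⟩)
  have hlξ : l < ξ := lt_of_le_of_ne hl.2 fun h => hlB (h ▸ hxB)
  obtain ⟨k, hk⟩ : ∃ k : ℤ, (realLift α b)^[n] ξ = ξ + k := by
    obtain ⟨k, hk⟩ := (AddCircle.coe_eq_zero_iff (1 : ℝ)).1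
      (show (((realLift α b)^[n] ξ - ξ : ℝ) : UnitAddCircle) = 0 by
        rw [AddCircle.coe_sub, hsemi, hper, sub_self])
    exact ⟨k, by simp only [zsmul_eq_mul, mul_one] at hk; linarith⟩
  set G : ℝ → ℝ := fun y => (realLift α b)^[n] y - k with hG
  have hGmono : Monotone G := fun s t hst => sub_le_sub_right (hmono.iterate n hst) _
  have hGcont : Continuous G := (hF.iterate n).sub continuous_const
  have hGsemi : ∀ y, (G y : UnitAddCircle) = (plpdm α b)^[n] (y : UnitAddCircle) := fun y => by
    rw [hG, coe_sub_intCast, hsemi]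
  have hGB : ∀ y, (G y : UnitAddCircle) ∈ B ↔ (y : UnitAddCircle) ∈ B := fun y => by
    rw [hGsemi]
    exact iterate_mem_basin_iff n
  have hGξ : G ξ = ξ := by simp [hG, hk]
  have hGl : G l = l := by
    refine le_antisymm ?_ ?_
    · by_contra! h
      exact hlB ((hGB l).1 (hgt _ h (hGξ ▸ hGmono hl.2)))
    · by_contra! h
      obtain ⟨y, hy, hyl⟩ := intermediate_value_Ioo hlξ.le hGcont.continuousOn
        ⟨h, hlξ.trans_eq hGξ.symm⟩
      exact hlB (hyl ▸ (hGB y).2 (hgt y hy.1 hy.2.le))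
  have hkink : ∀ i < n, ∀ m : ℤ,
      (1 / 2 + m : ℝ) ∉ Ioo ((realLift α b)^[i] l) ((realLift α b)^[i] ξ) := by
    intro i _ m hm
    obtain ⟨y, hy, hym⟩ := intermediate_value_Ioo hlξ.le (hF.iterate i).continuousOn hm
    set w := (realLift α b)^[i] ξ - m with hw
    have hwB : ∀ t ∈ Icc (1 / 2) w, (t : UnitAddCircle) ∈ B := by
      intro t ht
      obtain ⟨s, hs, hst⟩ := intermediate_value_Icc hy.2.le (hF.iterate i).continuousOn
        (show t + m ∈ Icc _ _ from ⟨by linarith [ht.1], by linarith [ht.2]⟩)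
      rw [show t = (realLift α b)^[i] s - m by linarith, coe_sub_intCast, hsemi]
      exact (iterate_mem_basin_iff i).2 (hgt s (hy.1.trans_le hs.1) hs.2)
    have hξw : ξ ≤ w := by
      rcases le_total w 1 with h | h
      · refine hmin _ (hxO i) w ⟨by linarith [hm.2], h⟩ ?_
        rw [hw, coe_sub_intCast, hsemi]
      · exact hξ.2.trans h
    exact hlB (hwB l ⟨hl.1, hl.2.trans hξw⟩)
  have hGle : ∀ y ∈ Icc l ξ, G y ≤ y := by
    intro y hy
    have hd := sub_pos.2 hlξ
    have hsum : (ξ - y) / (ξ - l) + (y - l) / (ξ - l) = 1 := by field_simp; ring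
    have hy' : (ξ - y) / (ξ - l) * l + (y - l) / (ξ - l) * ξ = y := by field_simp; ring
    have := iterate_realLift_convex_le α hb hl.2 hkink
      (div_nonneg (sub_nonneg.2 hy.2) hd.le) (div_nonneg (sub_nonneg.2 hy.1) hd.le) hsum
    rw [hy', show (realLift α b)^[n] l = l + k by linarith [hGl], hk] at this
    change (realLift α b)^[n] y - k ≤ y
    linear_combination this + hy' + k * hsum
  obtain ⟨y, hlim, hly, hyξ⟩ := (((hcoe.tendsto ξ).eventually hattr).filter_mono
    nhdsWithin_le_nhds |>.and (Ioo_mem_nhdsLT hlξ)).exists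
  have hanti := hGmono.antitone_iterate_of_map_le (hGle y ⟨hly.le, hyξ.le⟩)
  have hlow : ∀ j, l ≤ G^[j] y := fun j => by
    rw [← Function.iterate_fixed hGl j]
    exact hGmono.iterate j hly.le
  have hc := tendsto_atTop_ciInf hanti ⟨l, by rintro _ ⟨j, rfl⟩; exact hlow j⟩
  set c := ⨅ j, G^[j] y
  have hlc : l ≤ c := ge_of_tendsto' hc hlow
  have hcy : c ≤ y := le_of_tendsto' hc fun j => hanti (Nat.zero_le j)
  have hcξ : (c : UnitAddCircle) = ξ := by
    refine tendsto_nhds_unique (((hcoe.tendsto c).comp hc).congr fun j => ?_) hlim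
    rw [Function.iterate_mul]
    exact Function.Semiconj.iterate_right (f := fun t : ℝ => (t : UnitAddCircle)) hGsemi j y
  have := (AddCircle.coe_eq_coe_iff_of_mem_Ico (p := (1 : ℝ)) (a := c)
    ⟨le_rfl, by linarith⟩ ⟨by linarith, by linarith [hξ.2, hl.1]⟩).1 hcξ
  linarith
end
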